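/- Let π be an n-permutation and T(π) the corresponding EW-tableau. Then π avoids the pattern 213 if and only if both of the following hold: every row of T(π) consists of a (possibly empty) block of 0s followed by a (possibly empty) block of 1s; and in every row of T(π) containing a 1, the leftmost 1 of that row has no 1 below it in its column. -/

import Mathlib

/-- A Ferrers diagram (shape): `r` rows; row `i` (for `i < r`) has `len i` cells,
left-aligned, with row lengths weakly decreasing from top to bottom and positive.
`len` is normalized to vanish for `i ≥ r`. -/
structure FerrersShape where
  r : ℕ
  len : ℕ → ℕ
  r_pos : 0 < r
  anti : ∀ i j, i ≤ j → j < r → len j ≤ len i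
  len_pos : ∀ i, i < r → 0 < len i
  len_zero : ∀ i, r ≤ i → len i = 0

/-- An EW-tableau of shape `F` (`one` normalized to `false` outside the diagram). -/
structure EWTableau (F : FerrersShape) where
  one : ℕ → ℕ → Bool
  support : ∀ i j, one i j = true → i < F.r ∧ j < F.len i
  top_row : ∀ j, j < F.len 0 → one 0 j = true
  has_zero : ∀ i, 0 < i → i < F.r → ∃ j, j < F.len i ∧ one i j = false
  no_rect : ∀ i i' j j', i < i' → i' < F.r → j < j' → j' < F.len i' →
    ¬(one i j = one i' j' ∧ one i j' = one i' j ∧ one i j ≠ one i j')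

/-- The label of row `i` in the southeast-border labeling `0,1,…,n`. -/
def rowLabel (F : FerrersShape) (i : ℕ) : ℕ := i + (F.len 0 - F.len i)

/-- The label of column `j` in the southeast-border labeling `0,1,…,n`. -/
def colLabel (F : FerrersShape) (j : ℕ) : ℕ :=
  (F.len 0 - 1 - j) + ((Finset.range F.r).filter (fun i => j < F.len i)).card

/-- An `n`-permutation, encoded as a map `a : ℕ → ℕ` permuting `{1,…,n}`
(normalized to `0` off `{1,…,n}`); `a i` is the letter in place `i`. -/
def IsPermOn (n : ℕ) (a : ℕ → ℕ) : Prop :=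
  Set.BijOn a (Set.Icc 1 n) (Set.Icc 1 n) ∧ ∀ i, i ∉ Set.Icc 1 n → a i = 0

/-- The descent bottoms set of an `n`-permutation: `{a_{i+1} : a_i > a_{i+1}}`. -/
def DescBottoms (n : ℕ) (a : ℕ → ℕ) : Set ℕ :=
  {b | ∃ i, 1 ≤ i ∧ i < n ∧ a (i + 1) < a i ∧ a (i + 1) = b}

/-- `x` precedes `y` in the word `0π` (note `a 0 = 0`). -/
def Prec (n : ℕ) (a : ℕ → ℕ) (x y : ℕ) : Prop :=
  ∃ p q, p < q ∧ q ≤ n ∧ a p = x ∧ a q = y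

lemma row_lt_col (F : FerrersShape) (i j : ℕ) (hi : i < F.r) (hj : j < F.len i) :
    rowLabel F i < colLabel F j := by
  unfold rowLabel colLabel
  have h0 := F.anti 0 i (Nat.zero_le _) hi
  have : (Finset.range (i+1)) ⊆ (Finset.range F.r).filter (fun i => j < F.len i) := by
    intro x hx
    simp only [Finset.mem_range, Finset.mem_filter] at *
    have := F.anti x i (by omega) hi
    omega
  have := Finset.card_le_card this
  simp only [Finset.card_range] at this
  omega

lemma col_lt_row (F : FerrersShape) (i j : ℕ) (hi : i < F.r) (hj : j < F.len 0)
    (hj' : F.len i ≤ j) : colLabel F j < rowLabel F i := by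
  unfold rowLabel colLabel
  have h0 := F.anti 0 i (Nat.zero_le _) hi
  have : (Finset.range F.r).filter (fun i => j < F.len i) ⊆ (Finset.range i) := by
    intro x hx
    simp only [Finset.mem_range, Finset.mem_filter] at *
    by_contra hc
    have := F.anti i x (by omega) hx.1
    omega
  have := Finset.card_le_card this
  simp only [Finset.card_range] at this
  omega

lemma row_lt_row (F : FerrersShape) (i i' : ℕ) (hi : i < i') (hi' : i' < F.r) :
    rowLabel F i < rowLabel F i' := by
  unfold rowLabel
  have := F.anti i i' hi.le hi'
  omega

lemma col_lt_col (F : FerrersShape) (j j' : ℕ) (hj : j < j') (hj' : j' < F.len 0) :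
    colLabel F j' < colLabel F j := by
  unfold colLabel
  have : (Finset.range F.r).filter (fun i => j' < F.len i) ⊆
      (Finset.range F.r).filter (fun i => j < F.len i) := by
    intro x hx
    simp only [Finset.mem_range, Finset.mem_filter] at *
    omega
  have := Finset.card_le_card this
  omega

lemma row_le (F : FerrersShape) (i : ℕ) (hi : i < F.r) : rowLabel F i + 1 < F.r + F.len 0 := by
  unfold rowLabel
  have := F.anti 0 i (Nat.zero_le _) hi
  have := F.len_pos i hi
  omega

lemma col_le (F : FerrersShape) (j : ℕ) (hj : j < F.len 0) : colLabel F j < F.r + F.len 0 := by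
  unfold colLabel
  have := Finset.card_filter_le (Finset.range F.r) (fun i => j < F.len i)
  simp only [Finset.card_range] at this
  omega

lemma label_surj (F : FerrersShape) (x : ℕ) (hx : x < F.r + F.len 0) :
    (∃ i, i < F.r ∧ rowLabel F i = x) ∨ (∃ j, j < F.len 0 ∧ colLabel F j = x) := by
  classical
  have hR : ((Finset.range F.r).image (rowLabel F)).card = F.r := by
    rw [Finset.card_image_of_injOn, Finset.card_range]
    intro i hi i' hi' h
    simp only [Finset.coe_range, Set.mem_Iio] at hi hi'
    rcases lt_trichotomy i i' with h1 | h1 | h1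
    · have := row_lt_row F _ _ h1 hi'; omega
    · exact h1
    · have := row_lt_row F _ _ h1 hi; omega
  have hC : ((Finset.range (F.len 0)).image (colLabel F)).card = F.len 0 := by
    rw [Finset.card_image_of_injOn, Finset.card_range]
    intro i hi i' hi' h
    simp only [Finset.coe_range, Set.mem_Iio] at hi hi'
    rcases lt_trichotomy i i' with h1 | h1 | h1
    · have := col_lt_col F _ _ h1 hi'; omega
    · exact h1
    · have := col_lt_col F _ _ h1 hi; omega
  have hD : Disjoint ((Finset.range F.r).image (rowLabel F))
      ((Finset.range (F.len 0)).image (colLabel F)) := by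
    rw [Finset.disjoint_left]
    intro y hy hy'
    simp only [Finset.mem_image, Finset.mem_range] at hy hy'
    obtain ⟨i, hi, rfl⟩ := hy
    obtain ⟨j, hj, h⟩ := hy'
    rcases Nat.lt_or_ge j (F.len i) with h1 | h1
    · have := row_lt_col F i j hi h1; omega
    · have := col_lt_row F i j hi hj h1; omega
  have hU : ((Finset.range F.r).image (rowLabel F)) ∪
      ((Finset.range (F.len 0)).image (colLabel F)) = Finset.range (F.r + F.len 0) := by
    apply Finset.eq_of_subset_of_card_le
    · intro y hy
      simp only [Finset.mem_union, Finset.mem_image, Finset.mem_range] at *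
      rcases hy with ⟨i, hi, rfl⟩ | ⟨j, hj, rfl⟩
      · have := row_le F i hi; omega
      · exact col_le F j hj
    · rw [Finset.card_union_of_disjoint hD, hR, hC, Finset.card_range]
  have : x ∈ Finset.range (F.r + F.len 0) := Finset.mem_range.2 hx
  rw [← hU] at this
  simpa only [Finset.mem_union, Finset.mem_image, Finset.mem_range] using this

lemma perm_pos {n : ℕ} {a : ℕ → ℕ} (ha : IsPermOn n a) (p : ℕ) (h1 : 1 ≤ p) (h2 : p ≤ n) :
    1 ≤ a p ∧ a p ≤ n := ha.1.mapsTo ⟨h1, h2⟩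

lemma perm_zero {n : ℕ} {a : ℕ → ℕ} (ha : IsPermOn n a) : a 0 = 0 := ha.2 0 (by simp)

lemma perm_inj {n : ℕ} {a : ℕ → ℕ} (ha : IsPermOn n a) (p q : ℕ) (hp : p ≤ n) (hq : q ≤ n)
    (h : a p = a q) : p = q := by
  have h0 := perm_zero ha
  rcases Nat.eq_zero_or_pos p with rfl | hp' <;> rcases Nat.eq_zero_or_pos q with rfl | hq'
  · rfl
  · have := perm_pos ha q hq' hq; omega
  · have := perm_pos ha p hp' hp; omega
  · exact ha.1.injOn ⟨hp', hp⟩ ⟨hq', hq⟩ h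

lemma perm_surj {n : ℕ} {a : ℕ → ℕ} (ha : IsPermOn n a) (x : ℕ) (hx : x ≤ n) :
    ∃ p, p ≤ n ∧ a p = x := by
  rcases Nat.eq_zero_or_pos x with rfl | hx'
  · exact ⟨0, Nat.zero_le _, perm_zero ha⟩
  · obtain ⟨p, hp, h⟩ := ha.1.surjOn (show x ∈ Set.Icc 1 n from ⟨hx', hx⟩)
    exact ⟨p, hp.2, h⟩

lemma prec_iff {n : ℕ} {a : ℕ → ℕ} (ha : IsPermOn n a) (p q : ℕ) (hp : p ≤ n) (hq : q ≤ n) :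
    Prec n a (a p) (a q) ↔ p < q := by
  constructor
  · rintro ⟨p', q', h, hn, h1, h2⟩
    have := perm_inj ha p' p (by omega) hp h1
    have := perm_inj ha q' q hn hq h2
    omega
  · intro h
    exact ⟨p, q, h, hq, rfl, rfl⟩

/-- Walk back along a descending run to a letter that is not a descent bottom. -/
lemma run_top {n : ℕ} {a : ℕ → ℕ} (ha : IsPermOn n a) (p : ℕ) (h1 : 1 ≤ p) (h2 : p ≤ n) :
    ∃ q, 1 ≤ q ∧ q ≤ p ∧ a q ∉ DescBottoms n a ∧ ∀ s, q ≤ s → s ≤ p → a p ≤ a s := by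
  induction p using Nat.strong_induction_on with
  | _ p ih =>
    by_cases h : a p ∈ DescBottoms n a
    · obtain ⟨i, hi1, hi2, hlt, he⟩ := h
      have hip := perm_inj ha (i+1) p hi2 h2 he
      subst hip
      obtain ⟨q, hq1, hq2, hq3, hq4⟩ := ih i (by omega) hi1 hi2.le
      refine ⟨q, hq1, by omega, hq3, ?_⟩
      intro s hs1 hs2
      rcases Nat.lt_or_ge i s with h | h
      · have : s = i + 1 := by omega
        rw [this]
      · have := hq4 s hs1 h; omega
    · refine ⟨p, h1, le_rfl, h, ?_⟩
      intro s hs1 hs2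
      have : s = p := by omega
      rw [this]

/-- let `π` be an `n`-permutation and `T(π)` the corresponding
EW-tableau.  Then `π` avoids the pattern 213 iff every row of `T(π)` consists of
a (possibly empty) block of 0s followed by a (possibly empty) block of 1s, and in
every row containing a 1, the leftmost 1 of that row has no 1 below it in its
column. -/
theorem avoid213_iff_rows_zeros_then_ones (n : ℕ) (hn : 0 < n)
    (a : ℕ → ℕ) (ha : IsPermOn n a)
    (F : FerrersShape) (T : EWTableau F) (hsize : F.r + F.len 0 = n + 1)
    (hrows : DescBottoms n a = {x | ∃ i, 0 < i ∧ i < F.r ∧ rowLabel F i = x})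
    (hfill : ∀ i j, i < F.r → j < F.len i →
      (T.one i j = true ↔ Prec n a (rowLabel F i) (colLabel F j))) :
    (¬∃ i j k, 1 ≤ i ∧ i < j ∧ j < k ∧ k ≤ n ∧ a j < a i ∧ a i < a k) ↔
      ((∀ i j j', i < F.r → j < j' → j' < F.len i →
          T.one i j = true → T.one i j' = true) ∧
       (∀ i j, i < F.r → j < F.len i → T.one i j = true →
          (∀ j', j' < j → T.one i j' = false) →
          ∀ i', i < i' → i' < F.r → j < F.len i' → T.one i' j = false)) := by
  have h0 := perm_zero ha
  have hr0 : rowLabel F 0 = 0 := by simp [rowLabel]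
  -- cells in terms of positions
  have cell : ∀ i j p q, i < F.r → j < F.len i → p ≤ n → q ≤ n → a p = rowLabel F i →
      a q = colLabel F j → (T.one i j = true ↔ p < q) := by
    intro i j p q hi hj hp hq h1 h2
    rw [hfill i j hi hj, ← h1, ← h2, prec_iff ha p q hp hq]
  have rowpos : ∀ i, i < F.r → ∃ p, p ≤ n ∧ a p = rowLabel F i := fun i hi =>
    perm_surj ha _ (by have := row_le F i hi; omega)
  have colpos : ∀ j, j < F.len 0 → ∃ p, p ≤ n ∧ a p = colLabel F j := fun j hj =>
    perm_surj ha _ (by have := col_le F j hj; omega)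
  have isrow : ∀ p, 1 ≤ p → p ≤ n → a p ∈ DescBottoms n a →
      ∃ i, 0 < i ∧ i < F.r ∧ rowLabel F i = a p := by
    intro p _ _ h
    rw [hrows] at h
    exact h
  have iscol : ∀ p, 1 ≤ p → p ≤ n → a p ∉ DescBottoms n a →
      ∃ j, j < F.len 0 ∧ colLabel F j = a p := by
    intro p h1 h2 h
    have hp := perm_pos ha p h1 h2
    rcases label_surj F (a p) (by omega) with ⟨i, hi, he⟩ | h'
    · exfalso
      apply h
      rw [hrows]
      refine ⟨i, ?_, hi, he⟩
      rcases Nat.eq_zero_or_pos i with rfl | hi0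
      · omega
      · exact hi0
    · exact h'
  have inrow : ∀ i j, i < F.r → j < F.len 0 → rowLabel F i < colLabel F j → j < F.len i := by
    intro i j hi hj h
    by_contra hc
    have := col_lt_row F i j hi hj (by omega)
    omega
  have collt : ∀ j j', j < F.len 0 → j' < F.len 0 → colLabel F j' < colLabel F j → j < j' := by
    intro j j' hj hj' h
    rcases lt_trichotomy j j' with h1 | h1 | h1
    · exact h1
    · subst h1; omega
    · have := col_lt_col F _ _ h1 hj; omega
  have rowlt : ∀ j j', j < F.r → j' < F.r → rowLabel F j < rowLabel F j' → j < j' := by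
    intro j j' hj hj' h
    rcases lt_trichotomy j j' with h1 | h1 | h1
    · exact h1
    · subst h1; omega
    · have := row_lt_row F _ _ h1 hj; omega
  have len0 : ∀ i, i < F.r → F.len i ≤ F.len 0 := fun i hi => F.anti 0 i (Nat.zero_le _) hi
  constructor
  · intro hav
    constructor
    · intro i j j' hi hjj hj' hT
      have hl := len0 i hi
      obtain ⟨p, hp, hap⟩ := rowpos i hi
      obtain ⟨q, hq, haq⟩ := colpos j (by omega)
      obtain ⟨q', hq', haq'⟩ := colpos j' (by omega)
      rw [cell i j p q hi (by omega) hp hq hap haq] at hT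
      rw [cell i j' p q' hi hj' hp hq' hap haq']
      have e1 := row_lt_col F i j' hi hj'
      have e2 := col_lt_col F j j' hjj (by omega)
      by_contra hc
      have hne : q' ≠ p := by rintro rfl; omega
      have hq0 : q' ≠ 0 := by rintro rfl; omega
      exact hav ⟨q', p, q, by omega, by omega, by omega, hq, by omega, by omega⟩
    · intro i j hi hj hT hleft i' hii hi' hj'
      have hl := len0 i hi
      obtain ⟨p, hp, hap⟩ := rowpos i hi
      obtain ⟨p', hp', hap'⟩ := rowpos i' hi'
      obtain ⟨q, hq, haq⟩ := colpos j (by omega)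
      rw [cell i j p q hi (by omega) hp hq hap haq] at hT
      rw [← Bool.not_eq_true, cell i' j p' q hi' hj' hp' hq hap' haq]
      intro hlt
      have e1 := row_lt_row F i i' hii hi'
      have e2 := row_lt_col F i' j hi' hj'
      have hdb : a p' ∈ DescBottoms n a := by
        rw [hrows]; exact ⟨i', by omega, hi', hap'.symm⟩
      obtain ⟨d, hd1, hd2, hd3, hd4⟩ := hdb
      have hdp := perm_inj ha _ _ hd2 hp' hd4
      subst hdp
      have hdne : a d ≠ a q := by
        intro h
        have := perm_inj ha _ _ (by omega) hq h
        omega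
      have hdc : a q < a d := by
        by_contra hc
        exact hav ⟨d, d+1, q, hd1, by omega, hlt, hq, hd3, by omega⟩
      obtain ⟨D, hD1, hD2, hD3, hD4⟩ := run_top ha d hd1 (by omega)
      obtain ⟨m, hm, hcm⟩ := iscol D hD1 (by omega) hD3
      have hDd := hD4 D le_rfl hD2
      have hmj := collt m j hm (by omega) (by omega)
      have hf := hleft m hmj
      rw [← Bool.not_eq_true, cell i m p D hi (by omega) hp (by omega) hap hcm.symm] at hf
      have hpd : d < p := by
        by_contra hc
        have := hD4 p (by omega) (by omega)
        omega
      have : p ≠ d + 1 := by rintro rfl; omega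
      exact hav ⟨d+1, p, q, by omega, by omega, hT, hq, by omega, by omega⟩
  · rintro ⟨c1, c2⟩ ⟨x, y, z, hx, hxy, hyz, hz, hyx, hxz⟩
    -- first position after x with a smaller letter
    have hex : ∃ y, x < y ∧ a y < a x := ⟨y, hxy, hyx⟩
    classical
    obtain ⟨hs1, hs2⟩ := Nat.find_spec hex
    have hsm : Nat.find hex ≤ y := Nat.find_min' hex ⟨hxy, hyx⟩
    have hmin : ∀ m, m < Nat.find hex → ¬ (x < m ∧ a m < a x) := fun m hm => Nat.find_min hex hm
    generalize Nat.find hex = s at *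
    obtain ⟨t, rfl⟩ : ∃ t, s = t + 1 := ⟨s - 1, by omega⟩
    have hat : a x ≤ a t := by
      rcases Nat.eq_or_lt_of_le (show x ≤ t by omega) with rfl | h
      · exact le_rfl
      · have := hmin t (by omega)
        omega
    obtain ⟨i, hi0, hi, hri⟩ := isrow (t+1) (by omega) (by omega)
      ⟨t, by omega, by omega, by omega, rfl⟩
    obtain ⟨C, hC1, hC2, hC3, hC4⟩ := run_top ha z (by omega) hz
    obtain ⟨j, hj, hcj⟩ := iscol C hC1 (by omega) hC3
    have hCz := hC4 C le_rfl hC2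
    have htC : t + 1 < C := by
      by_contra hc
      have := hC4 (t+1) (by omega) (by omega)
      omega
    have hjl := inrow i j hi hj (by omega)
    have hT : T.one i j = true :=
      (cell i j (t+1) C hi hjl (by omega) (by omega) hri.symm hcj.symm).2 htC
    by_cases hb : a x ∈ DescBottoms n a
    · obtain ⟨i', hi'0, hi', hri'⟩ := isrow x hx (by omega) hb
      have hii := rowlt i i' hi hi' (by omega)
      have hex2 : ∃ j, T.one i j = true := ⟨j, hT⟩
      have hm1 := Nat.find_spec hex2
      have hm2 : Nat.find hex2 ≤ j := Nat.find_min' hex2 hT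
      have hm3 : ∀ m, m < Nat.find hex2 → ¬ T.one i m = true := fun m hm => Nat.find_min hex2 hm
      generalize Nat.find hex2 = m at *
      have hjl' := inrow i' j hi' hj (by omega)
      have hl' := len0 i' hi'
      have hf := c2 i m hi (by omega) hm1 (fun j' h => by simpa using hm3 j' h) i' hii hi' (by omega)
      obtain ⟨q, hq, haq⟩ := colpos m (by omega)
      rw [cell i m (t+1) q hi (by omega) (by omega) hq hri.symm haq] at hm1
      rw [← Bool.not_eq_true, cell i' m x q hi' (by omega) (by omega) hq hri'.symm haq] at hf
      omega
    · obtain ⟨j', hj', hcj'⟩ := iscol x hx (by omega) hb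
      have hjj := collt j j' hj hj' (by omega)
      have hjl' := inrow i j' hi hj' (by omega)
      have := c1 i j j' hi hjj hjl' hT
      rw [cell i j' (t+1) x hi hjl' (by omega) (by omega) hri.symm hcj'.symm] at this
      omega
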